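/- Property 1 (unbiased approximation) for LERG_S: Let S be a finite set with n = |S| ≥ 1, let N ≥ 1, and for each j ∈ {1,…,N} let p_j : Finset S → ℝ satisfy p_j(T) > 0 for all T ⊆ S. Define Φ_{ij} = ∑_{T ⊆ S \ {i}} (|T|!(n−|T|−1)!/n!) · (log p_j(T ∪ {i}) − log p_j(T)). Then ∑_{j=1}^{N} ∑_{i ∈ S} Φ_{ij} = log(∏_{j=1}^{N} p_j(S)) − log(∏_{j=1}^{N} p_j(∅)). -/

import Mathlib

/-- Double counting the pairs `i ∈ U ⊆ S` through `T = U \ {i}`. -/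
theorem Finset.sum_sum_powerset_erase_insert {α M : Type*} [DecidableEq α] [AddCommMonoid M]
    (S : Finset α) (f : Finset α → M) :
    ∑ i ∈ S, ∑ T ∈ (S.erase i).powerset, f (insert i T) =
      ∑ U ∈ S.powerset, U.card • f U := by
  calc ∑ i ∈ S, ∑ T ∈ (S.erase i).powerset, f (insert i T)
      = ∑ i ∈ S, ∑ U ∈ S.powerset with i ∈ U, f U := by
        refine Finset.sum_congr rfl fun i hi => ?_
        refine Finset.sum_nbij' (fun T => insert i T) (fun U => U.erase i) ?_ ?_ ?_ ?_ ?_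
        · intro T hT
          rw [Finset.mem_powerset] at hT
          simpa using Finset.insert_subset hi (hT.trans (Finset.erase_subset i S))
        · intro U hU
          rw [Finset.mem_filter, Finset.mem_powerset] at hU
          exact Finset.mem_powerset.2 (Finset.erase_subset_erase i hU.1)
        · intro T hT
          exact Finset.erase_insert fun h => by simpa using Finset.mem_powerset.1 hT h
        · intro U hU
          exact Finset.insert_erase (Finset.mem_filter.1 hU).2
        · intro T _
          rfl
    _ = ∑ U ∈ S.powerset, ∑ _i ∈ U, f U := by
        refine Finset.sum_comm' fun i U => ?_
        simp only [Finset.mem_filter, Finset.mem_powerset]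
        exact ⟨fun h => ⟨h.2.2, h.2.1⟩, fun h => ⟨h.2 h.1, h.2, h.1⟩⟩
    _ = ∑ U ∈ S.powerset, U.card • f U := by simp only [Finset.sum_const]

/-- Double counting the pairs `T ⊆ S`, `i ∈ S \ T`. -/
theorem Finset.sum_sum_powerset_erase {α M : Type*} [DecidableEq α] [AddCommMonoid M]
    (S : Finset α) (f : Finset α → M) :
    ∑ i ∈ S, ∑ T ∈ (S.erase i).powerset, f T =
      ∑ T ∈ S.powerset, (S.card - T.card) • f T := by
  calc ∑ i ∈ S, ∑ T ∈ (S.erase i).powerset, f T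
      = ∑ T ∈ S.powerset, ∑ _i ∈ S \ T, f T := by
        refine Finset.sum_comm' fun i T => ?_
        simp only [Finset.mem_powerset, Finset.mem_sdiff, Finset.subset_erase]
        tauto
    _ = ∑ T ∈ S.powerset, (S.card - T.card) • f T := by
        refine Finset.sum_congr rfl fun T hT => ?_
        rw [Finset.sum_const, Finset.card_sdiff_of_subset (Finset.mem_powerset.1 hT)]

/-- Efficiency of the Shapley value. -/
theorem sum_shapley_eq_sub {α : Type*} [DecidableEq α] (S : Finset α) (v : Finset α → ℝ) :
    ∑ i ∈ S, ∑ T ∈ (S.erase i).powerset,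
      ((T.card.factorial * (S.card - T.card - 1).factorial : ℕ) : ℝ) / (S.card.factorial : ℝ) *
        (v (insert i T) - v T) = v S - v ∅ := by
  set w : ℕ → ℝ := fun t =>
    ((t.factorial * (S.card - t - 1).factorial : ℕ) : ℝ) / (S.card.factorial : ℝ) with hw
  set c : ℕ → ℝ := fun t =>
    ((t.factorial * (S.card - t).factorial : ℕ) : ℝ) / (S.card.factorial : ℝ) with hc
  have hn : (S.card.factorial : ℝ) ≠ 0 := Nat.cast_ne_zero.2 S.card.factorial_ne_zero
  have hsplit : ∑ i ∈ S, ∑ T ∈ (S.erase i).powerset, w T.card * (v (insert i T) - v T) =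
      ∑ i ∈ S, ∑ T ∈ (S.erase i).powerset, w ((insert i T).card - 1) * v (insert i T) -
        ∑ i ∈ S, ∑ T ∈ (S.erase i).powerset, w T.card * v T := by
    simp only [← Finset.sum_sub_distrib]
    refine Finset.sum_congr rfl fun i _ => Finset.sum_congr rfl fun T hT => ?_
    have hi : i ∉ T := fun h => by simpa using Finset.mem_powerset.1 hT h
    rw [Finset.card_insert_of_notMem hi, Nat.add_sub_cancel, mul_sub]
  have hup : ∀ U ∈ S.powerset, U.card • (w (U.card - 1) * v U) =
      c U.card * v U - if U = ∅ then v ∅ else 0 := by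
    intro U hU
    have hle := Finset.card_le_card (Finset.mem_powerset.1 hU)
    split_ifs with h
    · subst h
      simp [hc, hn]
    · obtain ⟨k, hk⟩ := Nat.exists_eq_succ_of_ne_zero (Finset.card_ne_zero.2
        (Finset.nonempty_iff_ne_empty.2 h))
      have hsub : S.card - k - 1 = S.card - (k + 1) := by omega
      simp only [hw, hc, hk, Nat.succ_eq_add_one, Nat.add_sub_cancel, hsub, Nat.factorial_succ k,
        nsmul_eq_mul, Nat.cast_mul]
      ring
  have hdown : ∀ T ∈ S.powerset, (S.card - T.card) • (w T.card * v T) =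
      c T.card * v T - if T = S then v S else 0 := by
    intro T hT
    split_ifs with h
    · subst h
      simp [hc, hn]
    · obtain ⟨k, hk⟩ := Nat.exists_eq_succ_of_ne_zero (Nat.sub_ne_zero_of_lt
        (Finset.card_lt_card ((Finset.mem_powerset.1 hT).ssubset_of_ne h)))
      simp only [hw, hc, hk, Nat.succ_eq_add_one, Nat.add_sub_cancel, Nat.factorial_succ k,
        nsmul_eq_mul, Nat.cast_mul]
      ring
  rw [hsplit, Finset.sum_sum_powerset_erase_insert S fun U => w (U.card - 1) * v U,
    Finset.sum_sum_powerset_erase S fun T => w T.card * v T, Finset.sum_congr rfl hup,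
    Finset.sum_congr rfl hdown]
  simp

/-- Property 1 (unbiased approximation) for LERG_S:
`∑_{j=1}^N ∑_{i ∈ S} Φ_{ij} = log(∏_j p_j(S)) − log(∏_j p_j(∅))`, where
`Φ_{ij} = ∑_{T ⊆ S \ {i}} (|T|!(n−|T|−1)!/n!) (log p_j(T∪{i}) − log p_j(T))`. -/
theorem lergS_unbiased_approximation {α : Type*} [DecidableEq α]
    (S : Finset α) (n : ℕ) (hn : n = S.card) (hn1 : 1 ≤ n)
    (N : ℕ) (hN : 1 ≤ N) (p : Fin N → Finset α → ℝ)
    (hp : ∀ j : Fin N, ∀ T ⊆ S, 0 < p j T) :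
    ∑ j : Fin N, ∑ i ∈ S, ∑ T ∈ (S.erase i).powerset,
      ((T.card.factorial * (n - T.card - 1).factorial : ℕ) : ℝ) / (n.factorial : ℝ) *
        (Real.log (p j (insert i T)) - Real.log (p j T))
    = Real.log (∏ j : Fin N, p j S) - Real.log (∏ j : Fin N, p j ∅) := by
  subst hn
  rw [Real.log_prod fun j _ => (hp j S subset_rfl).ne',
    Real.log_prod fun j _ => (hp j ∅ (Finset.empty_subset S)).ne', ← Finset.sum_sub_distrib]
  exact Finset.sum_congr rfl fun j _ => sum_shapley_eq_sub S fun T => Real.log (p j T)
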